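/- Let n ≥ 1, let D ⊆ ℝⁿ be a bounded open set, let β ∈ ℝⁿ, and let v : ℝⁿ → ℂ be continuous on the closure of D, twice continuously differentiable on D, satisfy Δv(x) − 2·(Dv(x))(β) + |β|²·v(x) = 0 for all x ∈ D, and vanish on the topological frontier of D. Then v(x) = 0 for all x ∈ D. -/

import Mathlib

open scoped RealInnerProductSpace

/-- The Laplacian of `f : ℝⁿ → ℂ`: the sum of the second partial derivatives of `f`
along the standard orthonormal basis directions. -/
noncomputable def laplacian {n : ℕ} (f : EuclideanSpace ℝ (Fin n) → ℂ)
    (x : EuclideanSpace ℝ (Fin n)) : ℂ :=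
  ∑ i : Fin n,
    fderiv ℝ (fun y => fderiv ℝ f y (EuclideanSpace.single i (1 : ℝ))) x
      (EuclideanSpace.single i (1 : ℝ))

/-- The second derivative test: at a local maximum the second derivative is nonpositive. -/
theorem IsLocalMax.second_hasDerivAt_nonpos {h h' : ℝ → ℝ} {a c : ℝ} (hmax : IsLocalMax h a)
    (hd : ∀ᶠ t in nhds a, HasDerivAt h (h' t) t) (hd' : HasDerivAt h' c a) : c ≤ 0 := by
  by_contra! hc
  have hderiv : deriv h =ᶠ[nhds a] h' := hd.mono fun t ht => ht.deriv
  have hderiv2 : deriv (deriv h) a = c := by rw [hderiv.deriv_eq, hd'.deriv]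
  have hmin : IsLocalMin h a :=
    isLocalMin_of_deriv_deriv_pos (hderiv2 ▸ hc) hmax.deriv_eq_zero
      hd.self_of_nhds.continuousAt
  have hconst : h =ᶠ[nhds a] fun _ => h a := by
    filter_upwards [hmax, hmin] with t h1 h2 using le_antisymm h1 h2
  rw [hconst.deriv.deriv_eq] at hderiv2
  simp at hderiv2
  exact hc.ne hderiv2

section Conjugation

variable {E : Type*} [NormedAddCommGroup E] [InnerProductSpace ℝ E]

/-- The second derivative test, in a direction `e`, for the conjugate `exp (-⟨β, ·⟩) L (v ·)` of a
function `v` perturbed by `ε ‖·‖²`. -/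
theorem second_fderiv_conj_exp_add_le_zero_of_isLocalMax {F : Type*} [NormedAddCommGroup F]
    [NormedSpace ℝ F] {v : E → F} {x : E} (hv : ContDiffAt ℝ 2 v x)
    (L : F →L[ℝ] ℝ) (β e : E) (ε : ℝ)
    (hmax : IsLocalMax (fun y => Real.exp (-⟪β, y⟫) * L (v y) + ε * ‖y‖ ^ 2) x) :
    Real.exp (-⟪β, x⟫) * (L (fderiv ℝ (fun y => fderiv ℝ v y e) x e)
      - 2 * (⟪β, e⟫ * L (fderiv ℝ v x e)) + ⟪β, e⟫ ^ 2 * L (v x)) + 2 * ε * ‖e‖ ^ 2 ≤ 0 := by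
  have hline (t : ℝ) : HasDerivAt (fun t : ℝ => x + t • e) e t := by
    simpa using ((hasDerivAt_id t).smul_const e).const_add x
  have hx0 : x + (0 : ℝ) • e = x := by simp
  have htend : Filter.Tendsto (fun t : ℝ => x + t • e) (nhds 0) (nhds x) := by
    simpa using (hline 0).continuousAt.tendsto
  have hexp (t : ℝ) : HasDerivAt (fun t : ℝ => Real.exp (-⟪β, x + t • e⟫))
      (Real.exp (-⟪β, x + t • e⟫) * -⟪β, e⟫) t :=
    (((innerSL ℝ β).hasFDerivAt.comp_hasDerivAt t (hline t)).neg).exp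
  have hsq (t : ℝ) : HasDerivAt (fun t : ℝ => ε * ‖x + t • e‖ ^ 2)
      (ε * (2 * ⟪x + t • e, e⟫)) t := (hline t).norm_sq.const_mul ε
  have hsq' : HasDerivAt (fun t : ℝ => ε * (2 * ⟪x + t • e, e⟫)) (ε * (2 * ‖e‖ ^ 2)) 0 := by
    have := ((innerSL ℝ e).hasFDerivAt.comp_hasDerivAt 0 (hline 0)).const_mul (2 : ℝ)
    simpa [Function.comp_def, real_inner_comm] using this.const_mul ε
  have hfirst {t : ℝ} (ht : DifferentiableAt ℝ v (x + t • e)) :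
      HasDerivAt (fun t : ℝ => L (v (x + t • e))) (L (fderiv ℝ v (x + t • e) e)) t :=
    L.hasFDerivAt.comp_hasDerivAt t (ht.hasFDerivAt.comp_hasDerivAt t (hline t))
  have hdiff : ∀ᶠ y in nhds x, DifferentiableAt ℝ v y :=
    (hv.eventually (by simp)).mono fun y hy => hy.differentiableAt (by simp)
  have hsecond : HasDerivAt (fun t : ℝ => L (fderiv ℝ v (x + t • e) e))
      (L (fderiv ℝ (fun y => fderiv ℝ v y e) x e)) 0 := by
    have hd : DifferentiableAt ℝ (fun y => fderiv ℝ v y e) (x + (0 : ℝ) • e) := by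
      rw [hx0]
      exact ((hv.fderiv_right (m := 1) (by norm_num)).differentiableAt (by simp)).clm_apply
        (differentiableAt_const e)
    have := L.hasFDerivAt.comp_hasDerivAt (0 : ℝ)
      (hd.hasFDerivAt.comp_hasDerivAt (0 : ℝ) (hline 0))
    rwa [hx0] at this
  have hloc : IsLocalMax
      (fun t : ℝ => Real.exp (-⟪β, x + t • e⟫) * L (v (x + t • e)) + ε * ‖x + t • e‖ ^ 2) 0 := by
    filter_upwards [htend.eventually hmax] with t ht
    simpa using ht
  have hx : DifferentiableAt ℝ v (x + (0 : ℝ) • e) := by rw [hx0]; exact hdiff.self_of_nhds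
  have key := hloc.second_hasDerivAt_nonpos
    ((htend.eventually hdiff).mono fun t ht => ((hexp t).mul (hfirst ht)).add (hsq t))
    (((((hexp 0).mul_const (-⟪β, e⟫)).mul (hfirst hx)).add ((hexp 0).mul hsecond)).add hsq')
  simp only [hx0] at key
  linarith

end Conjugation

/-- The band gap operator applied to `v`, as a sum over the coordinate directions. -/
theorem laplacian_sub_add_eq_sum {n : ℕ} (v : EuclideanSpace ℝ (Fin n) → ℂ)
    (β x : EuclideanSpace ℝ (Fin n)) (L : ℂ →L[ℝ] ℝ) :
    L (laplacian v x - 2 * fderiv ℝ v x β + ((‖β‖ ^ 2 : ℝ) : ℂ) * v x) =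
      ∑ i : Fin n, (L (fderiv ℝ (fun y => fderiv ℝ v y (EuclideanSpace.single i (1 : ℝ))) x
          (EuclideanSpace.single i (1 : ℝ)))
        - 2 * (⟪β, EuclideanSpace.single i (1 : ℝ)⟫ *
          L (fderiv ℝ v x (EuclideanSpace.single i (1 : ℝ))))
        + ⟪β, EuclideanSpace.single i (1 : ℝ)⟫ ^ 2 * L (v x)) := by
  have hβ : β = ∑ i, β i • EuclideanSpace.single i (1 : ℝ) := by
    simpa using ((EuclideanSpace.basisFun (Fin n) ℝ).sum_repr β).symm
  have hD : L (fderiv ℝ v x β) = ∑ i, β i * L (fderiv ℝ v x (EuclideanSpace.single i 1)) := by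
    conv_lhs => rw [hβ]
    simp only [map_sum, map_smul, smul_eq_mul]
  have h2 : (2 : ℂ) * fderiv ℝ v x β = (2 : ℝ) • fderiv ℝ v x β := by simp
  rw [h2, ← Complex.real_smul, map_add, map_sub, map_smul, map_smul, hD, laplacian, map_sum,
    EuclideanSpace.real_norm_sq_eq, Finset.sum_add_distrib, Finset.sum_sub_distrib,
    ← Finset.mul_sum, ← Finset.sum_mul]
  simp [EuclideanSpace.inner_single_right]

/-- A solution of the band gap equation `Δv − 2 Dv(β) + |β|² v = 0` on a
bounded open set `D ⊆ ℝⁿ` which is continuous up to the boundary and vanishes on the frontier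
of `D` vanishes identically on `D`. -/
theorem band_gap_solution_vanishes_on_interior
    (n : ℕ) (hn : 1 ≤ n) (D : Set (EuclideanSpace ℝ (Fin n)))
    (hDopen : IsOpen D) (hDbdd : Bornology.IsBounded D)
    (β : EuclideanSpace ℝ (Fin n))
    (v : EuclideanSpace ℝ (Fin n) → ℂ)
    (hvcont : ContinuousOn v (closure D))
    (hvC2 : ContDiffOn ℝ 2 v D)
    (hpde : ∀ x ∈ D,
      laplacian v x - 2 * fderiv ℝ v x β + ((‖β‖ ^ 2 : ℝ) : ℂ) * v x = 0)
    (hbdry : ∀ x ∈ frontier D, v x = 0) :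
    ∀ x ∈ D, v x = 0 := by
  intro x hx
  have hxc : x ∈ closure D := subset_closure hx
  set L : ℂ →L[ℝ] ℝ := innerSL ℝ (v x)
  obtain ⟨R, hR⟩ := hDbdd.closure.exists_norm_le
  have hbound (ε : ℝ) (hε : 0 < ε) : Real.exp (-⟪β, x⟫) * L (v x) ≤ ε * R ^ 2 := by
    have hcont : ContinuousOn
        (fun y => Real.exp (-⟪β, y⟫) * L (v y) + ε * ‖y‖ ^ 2) (closure D) := by
      fun_prop
    obtain ⟨y, hy, hmax⟩ :=
      hDbdd.isCompact_closure.exists_isMaxOn ⟨x, hxc⟩ hcont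
    have hyD : y ∉ D := by
      intro hyD
      have hloc := hmax.isLocalMax (Filter.mem_of_superset (hDopen.mem_nhds hyD) subset_closure)
      have hsum := Finset.sum_nonpos (s := Finset.univ) fun (i : Fin n) _ =>
        second_fderiv_conj_exp_add_le_zero_of_isLocalMax
          (hvC2.contDiffAt (hDopen.mem_nhds hyD)) L β (EuclideanSpace.single i (1 : ℝ)) ε hloc
      rw [Finset.sum_add_distrib, ← Finset.mul_sum, ← laplacian_sub_add_eq_sum, hpde y hyD] at hsum
      have hn' : (0 : ℝ) < n := by exact_mod_cast hn
      have : 0 < (n : ℝ) * (2 * ε) := by positivity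
      simp at hsum
      linarith
    have hv0 : v y = 0 := hbdry y ⟨hy, by rwa [hDopen.interior_eq]⟩
    have hle := hmax hxc
    simp only [Set.mem_ofPred_eq, hv0, map_zero, mul_zero, zero_add] at hle
    have hyR : ‖y‖ ^ 2 ≤ R ^ 2 := pow_le_pow_left₀ (norm_nonneg y) (hR y hy) 2
    nlinarith [mul_le_mul_of_nonneg_left hyR hε.le, mul_nonneg hε.le (sq_nonneg ‖x‖)]
  have hnonpos : Real.exp (-⟪β, x⟫) * L (v x) ≤ 0 := by
    have htend : Filter.Tendsto (fun ε : ℝ => ε * R ^ 2) (nhdsWithin 0 (Set.Ioi 0)) (nhds 0) := by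
      have : Continuous fun ε : ℝ => ε * R ^ 2 := by fun_prop
      simpa using (this.tendsto 0).mono_left nhdsWithin_le_nhds
    exact ge_of_tendsto htend (Filter.mem_of_superset self_mem_nhdsWithin hbound)
  have hLv : L (v x) = ‖v x‖ ^ 2 := real_inner_self_eq_norm_sq (v x)
  have hle : ‖v x‖ ^ 2 ≤ 0 := hLv ▸ nonpos_of_mul_nonpos_right hnonpos (Real.exp_pos _)
  exact norm_eq_zero.mp (pow_eq_zero_iff two_ne_zero |>.mp (le_antisymm hle (sq_nonneg _)))
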